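/- arXiv:1308.4624 — 2 statements merged into one kernel-verified Lean document; each statement's English description precedes it below -/
import Mathlib

section
/- Let P be the standard parabolic subgroup of GL_n(F) determined by the indices 0 = M_0 < M_1 < ... < M_r = n, and let W be its Weyl group, the subgroup of permutation matrices corresponding to permutations of {1,...,n} that stabilize each interval O_i = {M_{i-1}+1,...,M_i}. Let C and D be n×n matrices over F, and let Y and Z be sub-permutation (0,1)-matrices that are B-equivalent to C and D respectively. Then C and D are P-equivalent if and only if Y and Z are W-equivalent. -/
open Matrix

variable {F : Type*} [Field F] {n : ℕ}

/-- Membership in `B`: invertible upper triangular matrices. -/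
def InB (h : Matrix (Fin n) (Fin n) F) : Prop :=
  IsUnit h.det ∧ ∀ i j : Fin n, j < i → h i j = 0

/-- A sub-permutation matrix: at most one nonzero entry in every row and column. -/
def SubPerm (Y : Matrix (Fin n) (Fin n) F) : Prop :=
  (∀ i j k : Fin n, Y i j ≠ 0 → Y i k ≠ 0 → j = k) ∧
  (∀ i j k : Fin n, Y i k ≠ 0 → Y j k ≠ 0 → i = j)

/-- A (0,1)-matrix: every entry is 0 or 1. -/
def ZeroOne (Y : Matrix (Fin n) (Fin n) F) : Prop :=
  ∀ i j, Y i j = 0 ∨ Y i j = 1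

/-- Membership in the standard parabolic subgroup `P` determined by
`0 = M 0 < M 1 < ... < M r = n`: invertible matrices stabilizing the span of the
first `M j` standard basis vectors for each `j ≤ r`. -/
def InP (M : ℕ → ℕ) (r : ℕ) (g : Matrix (Fin n) (Fin n) F) : Prop :=
  IsUnit g.det ∧ ∀ j ≤ r, ∀ a b : Fin n, (b : ℕ) < M j → M j ≤ (a : ℕ) → g a b = 0

/-- A permutation of `{1,...,n}` stabilizing each interval
`O i = {M (i-1)+1, ..., M i}` (0-indexed: `[M i, M (i+1))` for `i < r`). -/
def IntervalPerm (M : ℕ → ℕ) (r : ℕ) (σ : Equiv.Perm (Fin n)) : Prop :=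
  ∀ i < r, ∀ k : Fin n, M i ≤ (k : ℕ) → (k : ℕ) < M (i + 1) →
    M i ≤ ((σ k : Fin n) : ℕ) ∧ ((σ k : Fin n) : ℕ) < M (i + 1)

/-- The permutation matrix of `σ`, sending `e j` to `e (σ j)`. -/
def permMat (σ : Equiv.Perm (Fin n)) : Matrix (Fin n) (Fin n) F :=
  Matrix.of fun i j : Fin n => if i = σ j then (1 : F) else 0

open Finset in
/-- The index of the block containing `k`: the number of `j ≤ r` with `M j ≤ k`. -/
def blockIndex (M : ℕ → ℕ) (r : ℕ) (k : Fin n) : ℕ :=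
  #{j ∈ range (r + 1) | M j ≤ (k : ℕ)}

theorem blockIndex_lt_iff (M : ℕ → ℕ) (r : ℕ) (a b : Fin n) :
    blockIndex M r b < blockIndex M r a ↔ ∃ j ≤ r, (b : ℕ) < M j ∧ M j ≤ (a : ℕ) := by
  constructor
  · intro h
    by_contra! hc
    refine absurd h (not_lt.2 (Finset.card_le_card fun j hj => ?_))
    simp only [Finset.mem_filter, Finset.mem_range] at hj ⊢
    refine ⟨hj.1, not_lt.1 fun hb => ?_⟩
    have := hc j (by omega) hb
    omega
  · rintro ⟨j, hj, hb, ha⟩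
    refine Finset.card_lt_card ((Finset.ssubset_iff_of_subset fun i hi => ?_).2 ?_)
    · simp only [Finset.mem_filter, Finset.mem_range] at hi ⊢
      omega
    · exact ⟨j, by simp; omega, by simp; omega⟩

theorem inP_iff_blockTriangular {M : ℕ → ℕ} {r : ℕ} {g : Matrix (Fin n) (Fin n) F} :
    InP M r g ↔ IsUnit g.det ∧ g.BlockTriangular (blockIndex M r) := by
  refine and_congr_right fun _ => ⟨fun h a b hab => ?_, fun h j hj a b hb ha => h ?_⟩
  · obtain ⟨j, hj, hb, ha⟩ := (blockIndex_lt_iff M r a b).1 hab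
    exact h j hj a b hb ha
  · exact (blockIndex_lt_iff M r a b).2 ⟨j, hj, hb, ha⟩

theorem InP.mul {M : ℕ → ℕ} {r : ℕ} {g h : Matrix (Fin n) (Fin n) F}
    (hg : InP M r g) (hh : InP M r h) : InP M r (g * h) := by
  rw [inP_iff_blockTriangular] at *
  exact ⟨by rw [det_mul]; exact hg.1.mul hh.1, hg.2.mul hh.2⟩

theorem InP.inv {M : ℕ → ℕ} {r : ℕ} {g : Matrix (Fin n) (Fin n) F}
    (hg : InP M r g) : InP M r g⁻¹ := by
  rw [inP_iff_blockTriangular] at *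
  let _ := Matrix.invertibleOfIsUnitDet g hg.1
  exact ⟨Matrix.isUnit_nonsing_inv_det g hg.1, blockTriangular_inv_of_blockTriangular hg.2⟩

theorem InB.inP (M : ℕ → ℕ) (r : ℕ) {g : Matrix (Fin n) (Fin n) F} (hg : InB g) :
    InP M r g :=
  ⟨hg.1, fun _ _ a b hb ha => hg.2 a b (Fin.lt_def.2 (hb.trans_le ha))⟩

/-- `P`-equivalence of square matrices. -/
def PEquivalent (M : ℕ → ℕ) (r : ℕ) (X Y : Matrix (Fin n) (Fin n) F) : Prop :=
  ∃ h k : Matrix (Fin n) (Fin n) F, InP M r h ∧ InP M r k ∧ Y = hᵀ * X * k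

theorem PEquivalent.trans {M : ℕ → ℕ} {r : ℕ} {X Y Z : Matrix (Fin n) (Fin n) F}
    (hXY : PEquivalent M r X Y) (hYZ : PEquivalent M r Y Z) : PEquivalent M r X Z := by
  obtain ⟨h, k, hh, hk, rfl⟩ := hXY
  obtain ⟨h', k', hh', hk', rfl⟩ := hYZ
  exact ⟨h * h', k * k', hh.mul hh', hk.mul hk', by simp only [transpose_mul, Matrix.mul_assoc]⟩

theorem PEquivalent.symm {M : ℕ → ℕ} {r : ℕ} {X Y : Matrix (Fin n) (Fin n) F}
    (hXY : PEquivalent M r X Y) : PEquivalent M r Y X := by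
  obtain ⟨h, k, hh, hk, rfl⟩ := hXY
  refine ⟨h⁻¹, k⁻¹, hh.inv, hk.inv, ?_⟩
  have hT : (h⁻¹)ᵀ * hᵀ = 1 := by rw [← transpose_mul, mul_nonsing_inv h hh.1, transpose_one]
  calc X = ((h⁻¹)ᵀ * hᵀ) * X * (k * k⁻¹) := by rw [hT, mul_nonsing_inv k hk.1]; simp
    _ = _ := by simp only [Matrix.mul_assoc]

theorem permMat_conj_apply (σ τ : Equiv.Perm (Fin n)) (Y : Matrix (Fin n) (Fin n) F)
    (i j : Fin n) : ((permMat σ)ᵀ * Y * permMat τ : Matrix (Fin n) (Fin n) F) i j = Y (σ i) (τ j) := by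
  simp [Matrix.mul_apply, permMat]

theorem isUnit_det_permMat (σ : Equiv.Perm (Fin n)) :
    IsUnit (permMat σ : Matrix (Fin n) (Fin n) F).det := by
  refine isUnit_det_of_left_inverse (B := (permMat σ)ᵀ) ?_
  ext i j
  have := permMat_conj_apply σ σ (1 : Matrix (Fin n) (Fin n) F) i j
  rw [Matrix.mul_one] at this
  simp [this, Matrix.one_apply]

theorem IntervalPerm.inP_permMat {M : ℕ → ℕ} {r : ℕ} (hM0 : M 0 = 0)
    (hMmono : ∀ i < r, M i < M (i + 1)) {σ : Equiv.Perm (Fin n)} (hσ : IntervalPerm M r σ) :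
    InP M r (permMat σ : Matrix (Fin n) (Fin n) F) := by
  refine ⟨isUnit_det_permMat σ, fun j hj a b hb ha => ?_⟩
  have hcover : ∀ s ≤ r, (b : ℕ) < M s → ∃ i < s, M i ≤ (b : ℕ) ∧ (b : ℕ) < M (i + 1) := by
    intro s
    induction s with
    | zero => omega
    | succ s ih =>
      intro hs hbs
      by_cases h : (b : ℕ) < M s
      · obtain ⟨i, hi, h'⟩ := ih (by omega) h
        exact ⟨i, by omega, h'⟩
      · exact ⟨s, by omega, by omega, hbs⟩
  obtain ⟨i, hi, hib⟩ := hcover j hj hb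
  have hmono : ∀ d, i + 1 + d ≤ r → M (i + 1) ≤ M (i + 1 + d) := by
    intro d
    induction d with
    | zero => simp
    | succ d ih =>
      intro hd
      have := hMmono (i + 1 + d) (by omega)
      have := ih (by omega)
      rw [← add_assoc]
      omega
  have hij := hmono (j - (i + 1)) (by omega)
  rw [Nat.add_sub_cancel' (by omega)] at hij
  have := hσ i (by omega) b hib.1 hib.2
  have hne : a ≠ σ b := by
    rintro rfl
    omega
  simp [permMat, hne]

theorem intervalPerm_of_blockIndex {M : ℕ → ℕ} {r : ℕ} {σ : Equiv.Perm (Fin n)}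
    (h : ∀ k, blockIndex M r (σ k) = blockIndex M r k) : IntervalPerm M r σ := by
  intro i hi k hk hk'
  constructor
  · by_contra! hc
    exact ((blockIndex_lt_iff M r k (σ k)).2 ⟨i, hi.le, hc, hk⟩).ne (h k)
  · by_contra! hc
    exact ((blockIndex_lt_iff M r (σ k) k).2 ⟨i + 1, hi, hk', hc⟩).ne (h k).symm

open Finset in
/-- The positions of the nonzero entries of a matrix. -/
noncomputable def nonzeroEntries (A : Matrix (Fin n) (Fin n) F) : Finset (Fin n × Fin n) := by
  classical exact {p | A p.1 p.2 ≠ 0}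

theorem mem_nonzeroEntries {A : Matrix (Fin n) (Fin n) F} {p : Fin n × Fin n} :
    p ∈ nonzeroEntries A ↔ A p.1 p.2 ≠ 0 := by
  simp [nonzeroEntries]

theorem ZeroOne.eq_one {A : Matrix (Fin n) (Fin n) F} (h01 : ZeroOne A) {i j : Fin n}
    (h : A i j ≠ 0) : A i j = 1 :=
  (h01 i j).resolve_left h

/-- The rank of a sub-permutation (0,1)-matrix is the number of its nonzero entries. -/
theorem rank_eq_card_nonzeroEntries {A : Matrix (Fin n) (Fin n) F} (hA : SubPerm A)
    (h01 : ZeroOne A) : A.rank = (nonzeroEntries A).card := by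
  classical
  let U : Matrix (Fin n) (nonzeroEntries A) F := of fun i s => if i = s.1.1 then 1 else 0
  let V : Matrix (nonzeroEntries A) (Fin n) F := of fun s j => if j = s.1.2 then 1 else 0
  apply le_antisymm
  · have hUV : A = U * V := by
      ext i j
      simp only [Matrix.mul_apply, U, V, of_apply, mul_ite, mul_one, mul_zero]
      by_cases h : A i j = 0
      · rw [h, Finset.sum_eq_zero]
        rintro ⟨⟨a, b⟩, hs⟩ -
        rw [mem_nonzeroEntries] at hs
        split_ifs with h1 h2
        · subst h1 h2
          exact absurd h hs
        all_goals rfl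
      · rw [Finset.sum_eq_single ⟨(i, j), mem_nonzeroEntries.2 h⟩]
        · simp [h01.eq_one h]
        · rintro ⟨⟨a, b⟩, hs⟩ - hne
          split_ifs with h1 h2
          · subst h1 h2
            exact absurd rfl hne
          all_goals rfl
        · simp
    calc A.rank = (U * V).rank := congrArg _ hUV
      _ ≤ U.rank := rank_mul_le_left U V
      _ ≤ _ := by simpa using rank_le_card_width U
  · have hone : Uᵀ * A * Vᵀ = 1 := by
      ext ⟨⟨a, b⟩, hs⟩ ⟨⟨c, d⟩, ht⟩
      rw [mem_nonzeroEntries] at hs ht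
      have : (Uᵀ * A * Vᵀ) ⟨(a, b), mem_nonzeroEntries.2 hs⟩ ⟨(c, d), mem_nonzeroEntries.2 ht⟩
          = A a d := by
        simp [Matrix.mul_apply, U, V]
      rw [this, Matrix.one_apply]
      split_ifs with h
      · obtain ⟨rfl, rfl⟩ : a = c ∧ b = d := by simpa using h
        exact h01.eq_one hs
      · by_contra hne
        have hbd := hA.1 a b d hs hne
        subst hbd
        exact h (by simp [hA.2 a c b hs ht])
    calc (nonzeroEntries A).card = (1 : Matrix (nonzeroEntries A) (nonzeroEntries A) F).rank := by
          simp [rank_one]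
      _ = (Uᵀ * A * Vᵀ).rank := by rw [hone]
      _ ≤ (Uᵀ * A).rank := rank_mul_le_left _ _
      _ ≤ A.rank := rank_mul_le_right _ _

/-- The diagonal idempotent onto the coordinates lying in blocks of index less than `a`. -/
def cornerProj (b : Fin n → ℕ) (a : ℕ) : Matrix (Fin n) (Fin n) F :=
  diagonal fun i => if b i < a then 1 else 0

theorem cornerProj_mul_mul_apply (b : Fin n → ℕ) (a c : ℕ) (Y : Matrix (Fin n) (Fin n) F)
    (i j : Fin n) :
    (cornerProj b a * Y * cornerProj b c : Matrix (Fin n) (Fin n) F) i j = if b i < a ∧ b j < c then Y i j else 0 := by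
  by_cases h1 : b i < a <;> by_cases h2 : b j < c <;>
    simp [cornerProj, diagonal_mul, mul_diagonal, h1, h2]

theorem mul_cornerProj_of_blockTriangular {b : Fin n → ℕ} {h : Matrix (Fin n) (Fin n) F}
    (hh : h.BlockTriangular b) (a : ℕ) :
    h * cornerProj b a = cornerProj b a * (h * cornerProj b a) := by
  ext i j
  by_cases h1 : b i < a <;> by_cases h2 : b j < a <;>
    simp [cornerProj, diagonal_mul, mul_diagonal, h1, h2]
  exact hh (by omega)

theorem rank_corner_le {b : Fin n → ℕ} {h k Y : Matrix (Fin n) (Fin n) F}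
    (hh : h.BlockTriangular b) (hk : k.BlockTriangular b) (a c : ℕ) :
    (cornerProj b a * (hᵀ * Y * k) * cornerProj b c).rank ≤
      (cornerProj b a * Y * cornerProj b c).rank := by
  have hE : ((cornerProj b a : Matrix (Fin n) (Fin n) F))ᵀ = cornerProj b a :=
    diagonal_transpose _
  have hT : cornerProj b a * hᵀ = cornerProj b a * hᵀ * cornerProj b a := by
    have := congrArg transpose (mul_cornerProj_of_blockTriangular hh a)
    simpa only [transpose_mul, hE] using this
  have key : cornerProj b a * (hᵀ * Y * k) * cornerProj b c =
      (cornerProj b a * hᵀ) * (cornerProj b a * Y * cornerProj b c) * (k * cornerProj b c) := by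
    calc _ = (cornerProj b a * hᵀ) * Y * (k * cornerProj b c) := by
          simp only [Matrix.mul_assoc]
      _ = (cornerProj b a * hᵀ * cornerProj b a) * Y *
            (cornerProj b c * (k * cornerProj b c)) := by
          rw [← hT, ← mul_cornerProj_of_blockTriangular hk]
      _ = _ := by simp only [Matrix.mul_assoc]
  rw [key]
  exact (rank_mul_le_left _ _).trans (rank_mul_le_right _ _)

open Finset in
theorem rank_corner_eq_card {Y : Matrix (Fin n) (Fin n) F} (hY : SubPerm Y) (h01 : ZeroOne Y)
    (b : Fin n → ℕ) (a c : ℕ) :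
    (cornerProj b a * Y * cornerProj b c).rank =
      #{p ∈ nonzeroEntries Y | b p.1 < a ∧ b p.2 < c} := by
  have hne : ∀ i j, (cornerProj b a * Y * cornerProj b c : Matrix (Fin n) (Fin n) F) i j ≠ 0 ↔
      Y i j ≠ 0 ∧ b i < a ∧ b j < c := by
    intro i j
    rw [cornerProj_mul_mul_apply]
    split_ifs with h <;> simp [h]
  rw [rank_eq_card_nonzeroEntries]
  · congr 1
    ext p
    rw [mem_nonzeroEntries, mem_filter, mem_nonzeroEntries, hne]
  · exact ⟨fun i j k h h' => hY.1 i j k ((hne _ _).1 h).1 ((hne _ _).1 h').1,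
      fun i j k h h' => hY.2 i j k ((hne _ _).1 h).1 ((hne _ _).1 h').1⟩
  · intro i j
    rw [cornerProj_mul_mul_apply]
    split_ifs
    exacts [h01 i j, Or.inl rfl]

open Finset in
theorem card_block_add_card_corner {α : Type*} (S : Finset α) (u v : α → ℕ) (a c : ℕ) :
    #{p ∈ S | u p = a ∧ v p = c} + #{p ∈ S | u p < a ∧ v p < c + 1} +
        #{p ∈ S | u p < a + 1 ∧ v p < c} =
      #{p ∈ S | u p < a + 1 ∧ v p < c + 1} + #{p ∈ S | u p < a ∧ v p < c} := by
  simp only [card_filter, ← sum_add_distrib]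
  refine sum_congr rfl fun p _ => ?_
  split_ifs <;> omega

/-- Two injective families with the same labels are related by a label-preserving permutation. -/
theorem exists_perm_comp_eq {ι S γ : Type*} [Finite ι] (b : ι → γ) {f g : S → ι}
    (hf : Function.Injective f) (hg : Function.Injective g) (hfg : ∀ s, b (f s) = b (g s)) :
    ∃ σ : Equiv.Perm ι, (∀ s, σ (f s) = g s) ∧ ∀ i, b (σ i) = b i := by
  classical
  have := Fintype.ofFinite ι
  have key : ∀ c, ∃ e : Equiv.Perm {i // b i = c},
      ∀ s (h : b (f s) = c), (e ⟨f s, h⟩ : ι) = g s := by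
    intro c
    let f' : {s // b (f s) = c} → {i // b i = c} := fun s => ⟨f s.1, s.2⟩
    let g' : {s // b (f s) = c} → {i // b i = c} := fun s => ⟨g s.1, (hfg s.1).symm.trans s.2⟩
    have hf' : Function.Injective f' := fun s t h => Subtype.ext (hf (congrArg Subtype.val h))
    have hg' : Function.Injective g' := fun s t h => Subtype.ext (hg (congrArg Subtype.val h))
    let e : {x // x ∈ Set.range f'} ≃ {x // x ∈ Set.range g'} :=
      (Equiv.ofInjective f' hf').symm.trans (Equiv.ofInjective g' hg')
    refine ⟨e.extendSubtype, fun s h => ?_⟩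
    have hmem : f' ⟨s, h⟩ ∈ Set.range f' := ⟨_, rfl⟩
    have h1 := e.extendSubtype_apply_of_mem (f' ⟨s, h⟩) hmem
    have h2 : (Equiv.ofInjective f' hf').symm ⟨f' ⟨s, h⟩, hmem⟩ = ⟨s, h⟩ :=
      Equiv.ofInjective_symm_apply hf' _
    have h3 : (e ⟨f' ⟨s, h⟩, hmem⟩ : {i // b i = c}) = g' ⟨s, h⟩ := by
      simp only [e, Equiv.trans_apply, h2, Equiv.ofInjective_apply]
    exact congrArg Subtype.val (h1.trans h3)
  choose e he using key
  refine ⟨Equiv.ofFiberEquiv e, fun s => ?_, fun i => Equiv.ofFiberEquiv_map e i⟩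
  exact he _ s rfl

theorem PEquivalent.card_corner_le {M : ℕ → ℕ} {r : ℕ} {Y Z : Matrix (Fin n) (Fin n) F}
    (hY : SubPerm Y ∧ ZeroOne Y) (hZ : SubPerm Z ∧ ZeroOne Z) (h : PEquivalent M r Y Z)
    (a c : ℕ) :
    ((nonzeroEntries Z).filter
      fun p => blockIndex M r p.1 < a ∧ blockIndex M r p.2 < c).card ≤
    ((nonzeroEntries Y).filter
      fun p => blockIndex M r p.1 < a ∧ blockIndex M r p.2 < c).card := by
  rw [← rank_corner_eq_card hY.1 hY.2, ← rank_corner_eq_card hZ.1 hZ.2]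
  obtain ⟨h, k, hh, hk, rfl⟩ := h
  exact rank_corner_le (inP_iff_blockTriangular.1 hh).2 (inP_iff_blockTriangular.1 hk).2 a c

theorem PEquivalent.exists_intervalPerm {M : ℕ → ℕ} {r : ℕ} {Y Z : Matrix (Fin n) (Fin n) F}
    (hY : SubPerm Y ∧ ZeroOne Y) (hZ : SubPerm Z ∧ ZeroOne Z) (h : PEquivalent M r Y Z) :
    ∃ σ τ : Equiv.Perm (Fin n), IntervalPerm M r σ ∧ IntervalPerm M r τ ∧
      Z = (permMat σ)ᵀ * Y * permMat τ := by
  classical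
  have hcorner := fun a c => le_antisymm (h.card_corner_le hY hZ a c)
    (h.symm.card_corner_le hZ hY a c)
  let lab : Fin n × Fin n → ℕ × ℕ := fun p => (blockIndex M r p.1, blockIndex M r p.2)
  have hblock : ∀ q : ℕ × ℕ, ((nonzeroEntries Z).filter fun p => lab p = q).card =
      ((nonzeroEntries Y).filter fun p => lab p = q).card := by
    rintro ⟨a, c⟩
    have h1 := card_block_add_card_corner (nonzeroEntries Z)
      (fun p => blockIndex M r p.1) (fun p => blockIndex M r p.2) a c
    have h2 := card_block_add_card_corner (nonzeroEntries Y)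
      (fun p => blockIndex M r p.1) (fun p => blockIndex M r p.2) a c
    rw [hcorner, hcorner, hcorner, hcorner] at h1
    simp only [lab, Prod.mk.injEq]
    omega
  have hequiv : ∀ q, Nonempty ({p : nonzeroEntries Z // lab p = q} ≃
      {p : nonzeroEntries Y // lab p = q}) := by
    intro q
    have hcard : ∀ X : Matrix (Fin n) (Fin n) F,
        Fintype.card {p : nonzeroEntries X // lab p = q} =
          ((nonzeroEntries X).filter fun p => lab p = q).card := by
      intro X
      rw [← Fintype.card_coe]
      exact Fintype.card_congr ((Equiv.subtypeSubtypeEquivSubtypeInter _ (fun p => lab p = q)).trans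
        (Equiv.subtypeEquivRight fun p => by simp))
    exact ⟨Fintype.equivOfCardEq (by rw [hcard, hcard, hblock])⟩
  let φ : nonzeroEntries Z ≃ nonzeroEntries Y :=
    Equiv.ofFiberEquiv (f := fun p => lab p.1) (g := fun p => lab p.1)
      fun q => (hequiv q).some
  have hφ : ∀ s, lab (φ s).1 = lab s.1 := fun s =>
    Equiv.ofFiberEquiv_map (f := fun p : nonzeroEntries Z => lab p.1)
      (g := fun p : nonzeroEntries Y => lab p.1) _ s
  have hfst : ∀ {X : Matrix (Fin n) (Fin n) F}, SubPerm X →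
      Function.Injective fun s : nonzeroEntries X => s.1.1 := by
    rintro X hX ⟨⟨i, j⟩, hs⟩ ⟨⟨i', j'⟩, ht⟩ (rfl : i = i')
    rw [mem_nonzeroEntries] at hs ht
    simp [hX.1 i j j' hs ht]
  have hsnd : ∀ {X : Matrix (Fin n) (Fin n) F}, SubPerm X →
      Function.Injective fun s : nonzeroEntries X => s.1.2 := by
    rintro X hX ⟨⟨i, j⟩, hs⟩ ⟨⟨i', j'⟩, ht⟩ (rfl : j = j')
    rw [mem_nonzeroEntries] at hs ht
    simp [hX.2 i i' j hs ht]
  obtain ⟨σ, hσ, hσb⟩ := exists_perm_comp_eq (blockIndex M r) (hfst hZ.1)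
    ((hfst hY.1).comp φ.injective) fun s => (congrArg Prod.fst (hφ s)).symm
  obtain ⟨τ, hτ, hτb⟩ := exists_perm_comp_eq (blockIndex M r) (hsnd hZ.1)
    ((hsnd hY.1).comp φ.injective) fun s => (congrArg Prod.snd (hφ s)).symm
  refine ⟨σ, τ, intervalPerm_of_blockIndex hσb, intervalPerm_of_blockIndex hτb, ?_⟩
  have hmap : ∀ s : nonzeroEntries Z, (φ s).1 = (σ s.1.1, τ s.1.2) := fun s =>
    Prod.ext (hσ s).symm (hτ s).symm
  have hiff : ∀ i j, Z i j ≠ 0 ↔ Y (σ i) (τ j) ≠ 0 := by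
    intro i j
    constructor
    · intro hij
      have := mem_nonzeroEntries.1 (φ ⟨(i, j), mem_nonzeroEntries.2 hij⟩).2
      rwa [hmap] at this
    · intro hij
      obtain ⟨s, hs⟩ := φ.surjective ⟨(σ i, τ j), mem_nonzeroEntries.2 hij⟩
      have h1 := (hmap s).symm.trans (congrArg Subtype.val hs)
      simp only [Prod.mk.injEq, EmbeddingLike.apply_eq_iff_eq] at h1
      have := mem_nonzeroEntries.1 s.2
      rwa [h1.1, h1.2] at this
  ext i j
  rw [permMat_conj_apply]
  by_cases hij : Z i j = 0
  · rw [hij, not_not.1 (mt (hiff i j).2 (not_not.2 hij))]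
  · rw [hZ.2.eq_one hij, hY.2.eq_one ((hiff i j).1 hij)]

/-- `C` and `D` are `P`-equivalent iff their associated sub-permutation
(0,1)-matrices are `W`-equivalent, `W` being the Weyl group of `P`. -/
theorem P_equivalent_iff_W_equivalent (hn : 2 ≤ n) (r : ℕ) (M : ℕ → ℕ)
    (hM0 : M 0 = 0) (hMr : M r = n) (hMmono : ∀ i < r, M i < M (i + 1))
    (C D Y Z : Matrix (Fin n) (Fin n) F)
    (hY : SubPerm Y ∧ ZeroOne Y) (hZ : SubPerm Z ∧ ZeroOne Z)
    (hYC : ∃ h k : Matrix (Fin n) (Fin n) F, InB h ∧ InB k ∧ Y = hᵀ * C * k)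
    (hZD : ∃ h k : Matrix (Fin n) (Fin n) F, InB h ∧ InB k ∧ Z = hᵀ * D * k) :
    (∃ h k : Matrix (Fin n) (Fin n) F, InP M r h ∧ InP M r k ∧ D = hᵀ * C * k) ↔
      (∃ σ τ : Equiv.Perm (Fin n), IntervalPerm M r σ ∧ IntervalPerm M r τ ∧
        Z = (permMat σ)ᵀ * Y * permMat τ) := by
  have hCY : PEquivalent M r C Y := by
    obtain ⟨h, k, hh, hk, e⟩ := hYC
    exact ⟨h, k, hh.inP M r, hk.inP M r, e⟩
  have hDZ : PEquivalent M r D Z := by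
    obtain ⟨h, k, hh, hk, e⟩ := hZD
    exact ⟨h, k, hh.inP M r, hk.inP M r, e⟩
  constructor
  · intro hCD
    exact PEquivalent.exists_intervalPerm hY hZ (hCY.symm.trans (.trans hCD hDZ))
  · rintro ⟨σ, τ, hσ, hτ, e⟩
    have hYZ : PEquivalent M r Y Z :=
      ⟨_, _, hσ.inP_permMat hM0 hMmono, hτ.inP_permMat hM0 hMmono, e⟩
    exact hCY.trans (hYZ.trans hDZ.symm)
end

section
/- Let W be the subgroup of permutation matrices corresponding to permutations of {1,...,n} stabilizing each interval O_i = {M_{i-1}+1,...,M_i}, where 0 = M_0 < M_1 < ... < M_r = n. Let Y and Z be sub-permutation (0,1)-matrices with couples (f,σ) and (g,τ) respectively. Then Y and Z are W-equivalent if and only if for all 1 ≤ i, j ≤ r the number of indices k with f(k) ≠ 0, k ∈ O_i and σ(k) ∈ O_j equals the number of indices k with g(k) ≠ 0, k ∈ O_i and τ(k) ∈ O_j. -/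
open Matrix

variable {F : Type*} [Field F] {n : ℕ}

/-- `(f, σ)` is a `Y`-couple: `Y e_k = f k • e_(σ k)` for all `k`. -/
def IsCouple (Y : Matrix (Fin n) (Fin n) F) (f : Fin n → F) (σ : Equiv.Perm (Fin n)) :
    Prop :=
  ∀ i k : Fin n, Y i k = if i = σ k then f k else 0

open scoped Classical in
/-- The number of indices `k` in the support of `f` lying in `O i` whose image
`σ k` lies in `O j` (with `O i = [M (i-1), M i)` in 0-indexed terms). -/
noncomputable def coupleCount (M : ℕ → ℕ) (f : Fin n → F) (σ : Equiv.Perm (Fin n))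
    (i j : ℕ) : ℕ :=
  (Finset.univ.filter fun k : Fin n => f k ≠ 0 ∧
    M (i - 1) ≤ (k : ℕ) ∧ (k : ℕ) < M i ∧
    M (j - 1) ≤ ((σ k : Fin n) : ℕ) ∧ ((σ k : Fin n) : ℕ) < M j).card

/-- Finite types with equinumerous fibres over `γ` are equivalent over `γ`. -/
theorem exists_equiv_of_card_fiber_eq {α β γ : Type*} [Fintype α] [Fintype β] [DecidableEq γ]
    (u : α → γ) (v : β → γ)
    (h : ∀ c, (Finset.univ.filter fun a => u a = c).card =
      (Finset.univ.filter fun b => v b = c).card) :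
    ∃ e : α ≃ β, ∀ a, v (e a) = u a := by
  have hc (c : γ) : Nonempty ({a // u a = c} ≃ {b // v b = c}) := by
    refine Fintype.card_eq.mp ?_
    rw [Fintype.card_subtype, Fintype.card_subtype, h]
  let E (c : γ) := (hc c).some
  refine ⟨(Equiv.sigmaFiberEquiv u).symm.trans
    ((Equiv.sigmaCongrRight E).trans (Equiv.sigmaFiberEquiv v)), fun a => ?_⟩
  exact (E (u a) ⟨a, rfl⟩).2

/-- A bijection between two subsets of a finite type that preserves a colouring extends to a
permutation preserving the colouring. -/
theorem exists_perm_extending {α γ : Type*} [Fintype α] [DecidableEq γ] (c : α → γ)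
    (p q : α → Prop) [DecidablePred p] [DecidablePred q] (e : {a // p a} ≃ {a // q a})
    (he : ∀ a, c (e a) = c a) :
    ∃ π : Equiv.Perm α, (∀ a, c (π a) = c a) ∧ ∀ a : {a // p a}, π a = e a := by
  have split (s : α → Prop) [DecidablePred s] (x : γ) :
      (Finset.univ.filter fun a : {a // s a} => c a = x).card +
        (Finset.univ.filter fun a : {a // ¬ s a} => c a = x).card =
      (Finset.univ.filter fun a : α => c a = x).card := by
    simp only [Finset.card_filter]
    exact Fintype.sum_subtype_add_sum_subtype s fun a => if c a = x then 1 else 0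
  obtain ⟨e', hcompl⟩ := exists_equiv_of_card_fiber_eq
    (fun a : {a // ¬ p a} => c a) (fun a : {a // ¬ q a} => c a) fun x => by
      have hpq : (Finset.univ.filter fun a : {a // p a} => c a = x).card =
          (Finset.univ.filter fun a : {a // q a} => c a = x).card :=
        Finset.card_equiv e fun a => by simp [he]
      have := split p x
      have := split q x
      omega
  have hp (a : α) (h : p a) : Equiv.subtypeCongr e e' a = e ⟨a, h⟩ := by
    simp [Equiv.subtypeCongr, Equiv.sumCompl_symm_apply_of_pos h]
  have hn (a : α) (h : ¬ p a) : Equiv.subtypeCongr e e' a = e' ⟨a, h⟩ := by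
    simp [Equiv.subtypeCongr, Equiv.sumCompl_symm_apply_of_neg h]
  refine ⟨Equiv.subtypeCongr e e', fun a => ?_, fun a => hp a a.2⟩
  by_cases h : p a
  · rw [hp a h, he]
  · rw [hn a h, hcompl]

/-- The intervals `[M i, M (i + 1))`, `i < r`, are the colour classes of a colouring of `Fin n`. -/
theorem exists_block_index (r : ℕ) (M : ℕ → ℕ) (hM0 : M 0 = 0) (hMr : M r = n)
    (hMmono : ∀ i < r, M i < M (i + 1)) :
    ∃ c : Fin n → ℕ, (∀ k, c k < r) ∧
      ∀ k : Fin n, ∀ i < r, (M i ≤ (k : ℕ) ∧ (k : ℕ) < M (i + 1)) ↔ c k = i := by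
  have mono (i j : ℕ) (hij : i ≤ j) : j ≤ r → M i ≤ M j := by
    induction j, hij using Nat.le_induction with
    | base => exact fun _ => le_rfl
    | succ j _ ih => exact fun hj => (ih (by omega)).trans (hMmono j hj).le
  have hex (k : Fin n) : ∃ i < r, M i ≤ (k : ℕ) ∧ (k : ℕ) < M (i + 1) := by
    have hk : ∃ m, (k : ℕ) < M m := ⟨r, hMr ▸ k.2⟩
    obtain ⟨m, hm⟩ : ∃ m, Nat.find hk = m + 1 := by
      refine Nat.exists_eq_succ_of_ne_zero fun h0 => ?_
      have := Nat.find_spec hk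
      rw [h0, hM0] at this
      omega
    have hle : Nat.find hk ≤ r := Nat.find_min' hk (hMr ▸ k.2)
    exact ⟨m, by omega, not_lt.mp (Nat.find_min hk (by omega)), hm ▸ Nat.find_spec hk⟩
  choose c hcr hc using hex
  refine ⟨c, hcr, fun k i hi => ⟨fun h => ?_, fun h => h ▸ hc k⟩⟩
  have := hc k
  have := hcr k
  rcases lt_trichotomy (c k) i with h' | h' | h'
  · have := mono (c k + 1) i h' hi.le
    omega
  · exact h'
  · have := mono (i + 1) (c k) h' (hcr k).le
    omega

theorem intervalPerm_iff {r : ℕ} {M : ℕ → ℕ} {c : Fin n → ℕ} (hcr : ∀ k, c k < r)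
    (hc : ∀ k : Fin n, ∀ i < r, (M i ≤ (k : ℕ) ∧ (k : ℕ) < M (i + 1)) ↔ c k = i)
    (π : Equiv.Perm (Fin n)) : IntervalPerm M r π ↔ ∀ k, c (π k) = c k := by
  refine ⟨fun h k => ?_, fun h i hi k h₁ h₂ => ?_⟩
  · have hk := (hc k _ (hcr k)).mpr rfl
    exact (hc _ _ (hcr k)).mp (h _ (hcr k) k hk.1 hk.2)
  · rw [hc _ _ hi, h, ← hc _ _ hi]
    exact ⟨h₁, h₂⟩

open scoped Classical in
theorem coupleCount_succ {r : ℕ} {M : ℕ → ℕ} {c : Fin n → ℕ}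
    (hc : ∀ k : Fin n, ∀ i < r, (M i ≤ (k : ℕ) ∧ (k : ℕ) < M (i + 1)) ↔ c k = i)
    (f : Fin n → F) (σ : Equiv.Perm (Fin n)) {i j : ℕ} (hi : i < r) (hj : j < r) :
    coupleCount M f σ (i + 1) (j + 1) =
      (Finset.univ.filter fun k => f k ≠ 0 ∧ c k = i ∧ c (σ k) = j).card := by
  unfold coupleCount
  congr 1
  ext k
  simp only [Finset.mem_filter, Finset.mem_univ, true_and, Nat.add_sub_cancel,
    ← hc k i hi, ← hc (σ k) j hj, and_assoc]

theorem permMat_transpose_mul_mul_apply (Y : Matrix (Fin n) (Fin n) F)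
    (σ τ : Equiv.Perm (Fin n)) (i k : Fin n) :
    ((permMat σ)ᵀ * Y * permMat τ : Matrix (Fin n) (Fin n) F) i k = Y (σ i) (τ k) := by
  simp [Matrix.mul_apply, permMat]

theorem IsCouple.apply_ne_zero_iff {Y : Matrix (Fin n) (Fin n) F} {f : Fin n → F}
    {σ : Equiv.Perm (Fin n)} (h : IsCouple Y f σ) (i k : Fin n) :
    Y i k ≠ 0 ↔ i = σ k ∧ f k ≠ 0 := by
  rw [h i k]
  split_ifs with hi <;> simp [hi]

theorem ZeroOne.ext_of_ne_zero_iff {Y Z : Matrix (Fin n) (Fin n) F} (hY : ZeroOne Y)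
    (hZ : ZeroOne Z) {i j k l : Fin n} (h : Z i j ≠ 0 ↔ Y k l ≠ 0) : Z i j = Y k l := by
  rcases hY k l with hy | hy <;> rcases hZ i j with hz | hz <;> simp_all

/-- Two sub-permutation (0,1)-matrices are `W`-equivalent iff the counts of
support indices in `O i` mapped into `O j` agree for all `1 ≤ i, j ≤ r`. -/
theorem W_equivalent_iff_counts (hn : 2 ≤ n) (r : ℕ) (M : ℕ → ℕ)
    (hM0 : M 0 = 0) (hMr : M r = n) (hMmono : ∀ i < r, M i < M (i + 1))
    (Y Z : Matrix (Fin n) (Fin n) F)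
    (hY : SubPerm Y ∧ ZeroOne Y) (hZ : SubPerm Z ∧ ZeroOne Z)
    (f g : Fin n → F) (σ τ : Equiv.Perm (Fin n))
    (hfσ : IsCouple Y f σ) (hgτ : IsCouple Z g τ) :
    (∃ σ' τ' : Equiv.Perm (Fin n), IntervalPerm M r σ' ∧ IntervalPerm M r τ' ∧
        Z = (permMat σ')ᵀ * Y * permMat τ') ↔
      ∀ i j : ℕ, 1 ≤ i → i ≤ r → 1 ≤ j → j ≤ r →
        coupleCount M f σ i j = coupleCount M g τ i j := by
  classical
  obtain ⟨c, hcr, hc⟩ := exists_block_index r M hM0 hMr hMmono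
  simp only [intervalPerm_iff hcr hc]
  constructor
  · rintro ⟨σ', τ', hσ', hτ', hZY⟩ i j hi hir hj hjr
    obtain ⟨i, rfl⟩ := Nat.exists_eq_add_of_le' hi
    obtain ⟨j, rfl⟩ := Nat.exists_eq_add_of_le' hj
    rw [coupleCount_succ hc f σ hir hjr, coupleCount_succ hc g τ hir hjr]
    have key (l k : Fin n) : (l = τ k ∧ g k ≠ 0) ↔ (σ' l = σ (τ' k) ∧ f (τ' k) ≠ 0) := by
      rw [← hgτ.apply_ne_zero_iff, ← hfσ.apply_ne_zero_iff, hZY,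
        permMat_transpose_mul_mul_apply]
    refine (Finset.card_equiv τ' fun k => ?_).symm
    simp only [Finset.mem_filter, Finset.mem_univ, true_and, hτ']
    constructor
    · rintro ⟨hg, hi, hj⟩
      obtain ⟨h₁, h₂⟩ := (key (τ k) k).mp ⟨rfl, hg⟩
      exact ⟨h₂, hi, by rw [← h₁, hσ', hj]⟩
    · rintro ⟨hf, hi, hj⟩
      obtain ⟨h₁, h₂⟩ := (key (σ'.symm (σ (τ' k))) k).mpr ⟨by simp, hf⟩
      exact ⟨h₂, hi, by rw [← h₁, ← hσ', Equiv.apply_symm_apply, hj]⟩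
  · intro hcount
    obtain ⟨e, he⟩ := exists_equiv_of_card_fiber_eq
      (fun k : {k // g k ≠ 0} => (c k, c (τ k))) (fun k : {k // f k ≠ 0} => (c k, c (σ k))) (by
        rintro ⟨i, j⟩
        by_cases hij : i < r ∧ j < r
        · have h := hcount (i + 1) (j + 1) (by omega) hij.1 (by omega) hij.2
          rw [coupleCount_succ hc f σ hij.1 hij.2, coupleCount_succ hc g τ hij.1 hij.2] at h
          have sub (u : Fin n → F) (ρ : Equiv.Perm (Fin n)) :
              (Finset.univ.filter fun k : {k // u k ≠ 0} => (c k, c (ρ k)) = (i, j)).card =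
              (Finset.univ.filter fun k => u k ≠ 0 ∧ c k = i ∧ c (ρ k) = j).card := by
            simp only [← Fintype.card_subtype, Prod.mk.injEq]
            exact Fintype.card_congr
              (Equiv.subtypeSubtypeEquivSubtypeInter (fun k => u k ≠ 0)
                fun k => c k = i ∧ c (ρ k) = j)
          rw [sub, sub, h]
        · have emp (u : Fin n → F) (ρ : Equiv.Perm (Fin n)) :
              (Finset.univ.filter fun k : {k // u k ≠ 0} => (c k, c (ρ k)) = (i, j)) = ∅ := by
            refine Finset.filter_false_of_mem fun k _ h => hij ?_
            obtain ⟨rfl, rfl⟩ := Prod.mk.inj h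
            exact ⟨hcr _, hcr _⟩
          rw [emp, emp, Finset.card_empty, Finset.card_empty])
    obtain ⟨τ', hτ', hτe⟩ := exists_perm_extending c _ _ e fun k => congrArg Prod.fst (he k)
    -- `τ k ↦ σ (e k)` on the nonzero rows of `Z`
    let e' : {l // g (τ.symm l) ≠ 0} ≃ {l // f (σ.symm l) ≠ 0} :=
      (τ.symm.subtypeEquiv fun _ => Iff.rfl).trans
        (e.trans (σ.subtypeEquiv fun k => by simp))
    obtain ⟨σ', hσ', hσe⟩ := exists_perm_extending c _ _ e' fun l => by
      simpa [e'] using congrArg Prod.snd (he ⟨τ.symm l, l.2⟩)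
    have hσ'τ (k : Fin n) (hk : g k ≠ 0) : σ' (τ k) = σ (τ' k) := by
      rw [hτe ⟨k, hk⟩, hσe ⟨τ k, by simpa using hk⟩]
      simp [e']
    have hfg (k : Fin n) : f (τ' k) ≠ 0 → g k ≠ 0 := fun hk => by
      have h : τ' (e.symm ⟨τ' k, hk⟩) = τ' k := by rw [hτe, e.apply_symm_apply]
      exact τ'.injective h ▸ (e.symm ⟨τ' k, hk⟩).2
    refine ⟨σ', τ', hσ', hτ', ?_⟩
    ext l k
    rw [permMat_transpose_mul_mul_apply]
    refine ZeroOne.ext_of_ne_zero_iff hY.2 hZ.2 ?_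
    rw [hgτ.apply_ne_zero_iff, hfσ.apply_ne_zero_iff]
    constructor
    · rintro ⟨rfl, hg⟩
      exact ⟨hσ'τ k hg, by rw [hτe ⟨k, hg⟩]; exact (e ⟨k, hg⟩).2⟩
    · rintro ⟨h, hf⟩
      exact ⟨σ'.injective (h.trans (hσ'τ k (hfg k hf)).symm), hfg k hf⟩
end
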